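/- Let n ≥ 4 and let A be the {0,1}-adjacency matrix of a connected simple graph G on Fin n, viewed as a signed graph with all edges positive. Then: (1) for every integer k with 2 ≤ k ≤ n−2, the exterior power ∧^k A is balanced if and only if G is a path, or G is a cycle and k is odd; and (2) the exterior power ∧^{n−1} A is balanced if and only if G is bipartite, i.e. there exists f : Fin n → Bool such that A(u,v) = 1 implies f u ≠ f v. -/

import Mathlib

open Matrix Finset

def IsSignedMatrix {ι : Type*} (B : Matrix ι ι ℝ) : Prop :=
  B.IsSymm ∧ (∀ i, B i i = 0) ∧ ∀ i j, B i j = -1 ∨ B i j = 0 ∨ B i j = 1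

def IsBalancedMatrix {ι : Type*} [Fintype ι] (B : Matrix ι ι ℝ) : Prop :=
  ∃ D : Matrix ι ι ℝ, D.IsDiag ∧ (∀ i, D i i = 1 ∨ D i i = -1) ∧
    D * B * D = Matrix.of fun i j => |B i j|

def cartPow {n : ℕ} (A : Matrix (Fin n) (Fin n) ℝ) (k : ℕ) :
    Matrix (Fin k → Fin n) (Fin k → Fin n) ℝ :=
  Matrix.of fun u v => ∑ i : Fin k, A (u i) (v i) *
    ∏ j ∈ Finset.univ.erase i, (if u j = v j then (1 : ℝ) else 0)

noncomputable def enumOf {n k : ℕ} (r : LinearOrder (Fin n)) (S : Finset (Fin n))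
    (h : S.card = k) : Fin k → Fin n :=
  fun i => ((@Finset.orderIsoOfFin (Fin n) r S k h) i : Fin n)

noncomputable def altOf {n : ℕ} (k : ℕ) (r : LinearOrder (Fin n)) :
    Matrix (Fin k → Fin n) {S : Finset (Fin n) // S.card = k} ℝ :=
  Matrix.of fun u S =>
    (Real.sqrt (Nat.factorial k))⁻¹ *
      ∑ π : Equiv.Perm (Fin k),
        if u = enumOf r S.1 S.2 ∘ π then ((Equiv.Perm.sign π : ℤ) : ℝ) else 0

noncomputable def alt (n k : ℕ) :
    Matrix (Fin k → Fin n) {S : Finset (Fin n) // S.card = k} ℝ :=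
  altOf k inferInstance

noncomputable def extPow {n : ℕ} (A : Matrix (Fin n) (Fin n) ℝ) (k : ℕ) :
    Matrix {S : Finset (Fin n) // S.card = k} {S : Finset (Fin n) // S.card = k} ℝ :=
  (alt n k)ᵀ * cartPow A k * alt n k

def IsPathMatrix {n : ℕ} (A : Matrix (Fin n) (Fin n) ℝ) : Prop :=
  ∃ g : Equiv.Perm (Fin n), ∀ i j : Fin n,
    |A (g i) (g j)| = 1 ↔ ((i : ℤ) - j = 1 ∨ (j : ℤ) - i = 1)

def IsCycleMatrix {n : ℕ} (A : Matrix (Fin n) (Fin n) ℝ) : Prop :=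
  3 ≤ n ∧ ∃ g : Equiv.Perm (Fin n), ∀ i j : Fin n,
    |A (g i) (g j)| = 1 ↔
      ((i : ℤ) - j ≡ 1 [ZMOD (n : ℤ)] ∨ (i : ℤ) - j ≡ -1 [ZMOD (n : ℤ)])

def signedAdjGraph {n : ℕ} (A : Matrix (Fin n) (Fin n) ℝ) : SimpleGraph (Fin n) :=
  SimpleGraph.fromRel (fun u v => |A u v| = 1)

open Equiv

theorem cartPow_comp_perm {n k : ℕ} (A : Matrix (Fin n) (Fin n) ℝ) (u v : Fin k → Fin n)
    (π : Perm (Fin k)) : cartPow A k (u ∘ π) (v ∘ π) = cartPow A k u v := by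
  simp only [cartPow, Matrix.of_apply, Function.comp]
  refine Fintype.sum_equiv π _ _ fun i => ?_
  congr 1
  refine Finset.prod_equiv π ?_ ?_
  · simp
  · simp

theorem extPow_apply {n k : ℕ} (A : Matrix (Fin n) (Fin n) ℝ)
    (S T : {S : Finset (Fin n) // S.card = k}) :
    extPow A k S T = ∑ σ : Perm (Fin k), ((Perm.sign σ : ℤ) : ℝ) *
      cartPow A k (S.1.orderEmbOfFin S.2) (T.1.orderEmbOfFin T.2 ∘ σ) := by
  have halt : ∀ (X : (Fin k → Fin n) → ℝ) (S : {S : Finset (Fin n) // S.card = k}),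
      ∑ u, alt n k u S * X u = (Real.sqrt (Nat.factorial k))⁻¹ *
        ∑ π : Perm (Fin k), ((Perm.sign π : ℤ) : ℝ) * X (S.1.orderEmbOfFin S.2 ∘ π) := by
    intro X S
    have henum : enumOf inferInstance S.1 S.2 = S.1.orderEmbOfFin S.2 := rfl
    simp only [alt, altOf, Matrix.of_apply, henum, mul_assoc, ← Finset.mul_sum, Finset.sum_mul]
    rw [Finset.sum_comm]
    simp
  have h1 : extPow A k S T = ∑ u, alt n k u T * ∑ v, alt n k v S * cartPow A k v u := by
    simp only [extPow, Matrix.mul_apply, Matrix.transpose_apply]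
    exact Finset.sum_congr rfl fun _ _ => mul_comm _ _
  have h2 : ∀ π σ : Perm (Fin k), ((Perm.sign (σ * π) : ℤ) : ℝ) * (((Perm.sign π : ℤ) : ℝ) *
      cartPow A k (S.1.orderEmbOfFin S.2 ∘ π) (T.1.orderEmbOfFin T.2 ∘ (σ * π : Perm (Fin k)))) =
      ((Perm.sign σ : ℤ) : ℝ) *
        cartPow A k (S.1.orderEmbOfFin S.2) (T.1.orderEmbOfFin T.2 ∘ σ) := by
    intro π σ
    rw [Perm.coe_mul, ← Function.comp_assoc, cartPow_comp_perm, ← mul_assoc]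
    congr 1
    rcases Int.units_eq_one_or (Perm.sign π) with h | h <;> simp [h]
  simp only [h1, halt, mul_left_comm _ (Real.sqrt _)⁻¹, ← Finset.mul_sum]
  rw [← mul_assoc, ← mul_inv, Real.mul_self_sqrt (by positivity)]
  simp only [Finset.mul_sum (Finset.univ : Finset (Perm (Fin k)))]
  rw [Finset.sum_comm]
  have h3 : ∀ π : Perm (Fin k), ∑ σ : Perm (Fin k), ((k.factorial : ℝ))⁻¹ *
      (((Perm.sign σ : ℤ) : ℝ) * (((Perm.sign π : ℤ) : ℝ) *
      cartPow A k (S.1.orderEmbOfFin S.2 ∘ π) (T.1.orderEmbOfFin T.2 ∘ σ))) =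
      ((k.factorial : ℝ))⁻¹ * ∑ σ : Perm (Fin k), ((Perm.sign σ : ℤ) : ℝ) *
        cartPow A k (S.1.orderEmbOfFin S.2) (T.1.orderEmbOfFin T.2 ∘ σ) := by
    intro π
    rw [Finset.mul_sum]
    refine (Fintype.sum_equiv (Equiv.mulRight π) _ _ fun σ => ?_).symm
    rw [Equiv.coe_mulRight, h2]
  simp only [Finset.mul_sum] at h3 ⊢
  rw [Finset.sum_congr rfl fun π _ => h3 π]
  simp only [← Finset.mul_sum]
  rw [Finset.sum_const, Finset.card_univ, Fintype.card_perm, Fintype.card_fin, nsmul_eq_mul,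
    ← mul_assoc, inv_mul_cancel₀ (by positivity), one_mul]

/-- A consistent choice of signs for the injective tuples: alternating under permutations of the
coordinates and unchanged when one coordinate moves along an edge to a free vertex. -/
def IsOrientation {n k : ℕ} (A : Matrix (Fin n) (Fin n) ℝ) (s : (Fin k → Fin n) → ℤˣ) : Prop :=
  (∀ u, Function.Injective u → ∀ π : Perm (Fin k), s (u ∘ π) = Perm.sign π * s u) ∧
  ∀ u i w, Function.Injective u → (∀ j, u j ≠ w) → A (u i) w = 1 →
    s (Function.update u i w) = s u

theorem injective_update {α β : Type*} [DecidableEq α] {u : α → β}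
    (hu : Function.Injective u) (i : α) {w : β} (hw : ∀ j, u j ≠ w) :
    Function.Injective (Function.update u i w) := by
  intro a b h
  by_cases ha : a = i <;> by_cases hb : b = i
  · rw [ha, hb]
  · subst ha; simp [hb] at h; exact absurd h.symm (hw b)
  · subst hb; simp [ha] at h; exact absurd h (hw a)
  · simp [ha, hb] at h; exact hu h

section CartPow

variable {n k : ℕ} {A : Matrix (Fin n) (Fin n) ℝ}

theorem cartPow_nonneg (h01 : ∀ i j, A i j = 0 ∨ A i j = 1) (u v : Fin k → Fin n) :
    0 ≤ cartPow A k u v := by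
  rw [cartPow, Matrix.of_apply]
  refine Finset.sum_nonneg fun i _ => mul_nonneg ?_ (Finset.prod_nonneg fun j _ => ?_)
  · rcases h01 (u i) (v i) with h | h <;> simp [h]
  · split_ifs <;> norm_num

theorem exists_update_of_cartPow_ne_zero (hdiag : ∀ i, A i i = 0)
    (h01 : ∀ i j, A i j = 0 ∨ A i j = 1) {u v : Fin k → Fin n} (hv : Function.Injective v)
    (h : cartPow A k u v ≠ 0) :
    ∃ i w, v = Function.update u i w ∧ (∀ j, u j ≠ w) ∧ A (u i) w = 1 := by
  rw [cartPow, Matrix.of_apply] at h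
  obtain ⟨i, -, hi⟩ := Finset.exists_ne_zero_of_sum_ne_zero h
  have hA : A (u i) (v i) = 1 := (h01 _ _).resolve_left (left_ne_zero_of_mul hi)
  have hj : ∀ j, j ≠ i → u j = v j := by
    intro j hj
    by_contra hne
    exact right_ne_zero_of_mul hi
      (Finset.prod_eq_zero (Finset.mem_erase.2 ⟨hj, Finset.mem_univ j⟩) (if_neg hne))
  refine ⟨i, v i, ?_, ?_, hA⟩
  · ext1 j
    by_cases hji : j = i
    · subst hji; simp
    · simp [hji, hj j hji]
  · intro j hjv
    by_cases hji : j = i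
    · subst hji; rw [hjv, hdiag] at hA; exact zero_ne_one hA
    · exact hji (hv ((hj j hji).symm.trans hjv))

theorem cartPow_update (u : Fin k → Fin n) (i : Fin k) {w : Fin n} (hw : ∀ j, u j ≠ w) :
    cartPow A k u (Function.update u i w) = A (u i) w := by
  simp only [cartPow, Matrix.of_apply]
  rw [Finset.sum_eq_single i]
  · rw [Finset.prod_eq_one, mul_one, Function.update_self]
    intro j hj
    simp [(Finset.mem_erase.1 hj).1]
  · intro j _ hji
    rw [Finset.prod_eq_zero (i := i), mul_zero]
    · simp [hji.symm]
    · simp [hw i]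
  · simp

theorem exists_eq_orderEmbOfFin_comp {u : Fin k → Fin n} (hu : Function.Injective u) :
    ∃ (S : {S : Finset (Fin n) // S.card = k}) (π : Perm (Fin k)),
      u = S.1.orderEmbOfFin S.2 ∘ π := by
  have hc : (Finset.univ.image u).card = k := by
    rw [Finset.card_image_of_injective _ hu, Finset.card_univ, Fintype.card_fin]
  refine ⟨⟨Finset.univ.image u, hc⟩, ?_⟩
  have hmem : ∀ i, ∃ j, (Finset.univ.image u).orderEmbOfFin hc j = u i := by
    intro i
    have : u i ∈ Set.range ((Finset.univ.image u).orderEmbOfFin hc) := by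
      rw [Finset.range_orderEmbOfFin]; simp
    exact this
  choose p hp using hmem
  have hpi : Function.Injective p := fun a b hab => hu (by rw [← hp a, ← hp b, hab])
  exact ⟨Equiv.ofBijective p (Finite.injective_iff_bijective.1 hpi), funext fun i => (hp i).symm⟩

theorem orderEmbOfFin_comp_injective {S T : {S : Finset (Fin n) // S.card = k}}
    {π ρ : Perm (Fin k)}
    (h : S.1.orderEmbOfFin S.2 ∘ π = T.1.orderEmbOfFin T.2 ∘ ρ) : S = T ∧ π = ρ := by
  have hST : S = T := by
    have := congrArg Set.range h
    rw [EquivLike.range_comp, EquivLike.range_comp, Finset.range_orderEmbOfFin,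
      Finset.range_orderEmbOfFin] at this
    exact Subtype.ext (Finset.coe_injective this)
  subst hST
  exact ⟨rfl, Equiv.ext fun i => (S.1.orderEmbOfFin S.2).injective (congrFun h i)⟩

theorem extPow_of_update (hdiag : ∀ i, A i i = 0) (h01 : ∀ i j, A i j = 0 ∨ A i j = 1)
    {S T : {S : Finset (Fin n) // S.card = k}} {π ρ : Perm (Fin k)} {i : Fin k} {w : Fin n}
    (hw : ∀ j, S.1.orderEmbOfFin S.2 (π j) ≠ w)
    (hA : A (S.1.orderEmbOfFin S.2 (π i)) w = 1)
    (hT : Function.update (S.1.orderEmbOfFin S.2 ∘ π) i w = T.1.orderEmbOfFin T.2 ∘ ρ) :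
    extPow A k S T = ((Perm.sign π * Perm.sign ρ : ℤˣ) : ℤ) := by
  set u := S.1.orderEmbOfFin S.2 ∘ π with hu
  have hui : Function.Injective u := (S.1.orderEmbOfFin S.2).injective.comp π.injective
  have hcart : ∀ σ : Perm (Fin k), cartPow A k (S.1.orderEmbOfFin S.2) (T.1.orderEmbOfFin T.2 ∘ σ) =
      cartPow A k u (T.1.orderEmbOfFin T.2 ∘ (σ * π : Perm (Fin k))) := by
    intro σ
    rw [hu, Perm.coe_mul, ← Function.comp_assoc, cartPow_comp_perm]
  rw [extPow_apply, Finset.sum_eq_single (ρ * π⁻¹)]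
  · rw [hcart, inv_mul_cancel_right, ← hT, cartPow_update u i hw]
    change _ * A (S.1.orderEmbOfFin S.2 (π i)) w = _
    rw [hA, mul_one, Perm.sign_mul, Perm.sign_inv, mul_comm]
  · intro σ _ hσ
    refine mul_eq_zero_of_right _ ?_
    by_contra hne
    rw [hcart] at hne
    obtain ⟨j, x, hx, hxu, -⟩ := exists_update_of_cartPow_ne_zero hdiag h01
      ((T.1.orderEmbOfFin T.2).injective.comp (σ * π).injective) hne
    have hrange : Set.range (Function.update u j x) = Set.range (Function.update u i w) := by
      rw [hT, ← hx, EquivLike.range_comp, EquivLike.range_comp]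
    have hxw : w = x := by
      have : w ∈ Set.range (Function.update u j x) := hrange ▸ ⟨i, by simp⟩
      obtain ⟨l, hl⟩ := this
      by_cases hlj : l = j
      · subst hlj; simpa using hl.symm
      · rw [Function.update_of_ne hlj] at hl; exact absurd hl (hw l)
    have hji : j = i := by
      by_contra hji
      have : u i ∈ Set.range (Function.update u i w) :=
        hrange ▸ ⟨i, by rw [Function.update_of_ne (Ne.symm hji)]⟩
      obtain ⟨l, hl⟩ := this
      by_cases hli : l = i
      · subst hli; rw [Function.update_self] at hl; exact hw l hl.symm
      · rw [Function.update_of_ne hli] at hl; exact hli (hui hl)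
    subst hxw hji
    have := (orderEmbOfFin_comp_injective (hx.trans hT)).2
    exact hσ (by rw [← this, mul_inv_cancel_right])
  · simp

theorem isBalancedMatrix_extPow_iff (hdiag : ∀ i, A i i = 0)
    (h01 : ∀ i j, A i j = 0 ∨ A i j = 1) :
    IsBalancedMatrix (extPow A k) ↔ ∃ s : (Fin k → Fin n) → ℤˣ, IsOrientation A s := by
  constructor
  · rintro ⟨D, hD, hD1, hDB⟩
    have hent : ∀ S T, D S S * extPow A k S T * D T T = |extPow A k S T| := by
      intro S T
      have := congrFun (congrFun hDB S) T
      rw [← hD.diagonal_diag] at this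
      simpa using this
    have hd : ∀ S, ∃ e : ℤˣ, D S S = ((e : ℤ) : ℝ) := by
      intro S
      rcases hD1 S with h | h
      · exact ⟨1, by simp [h]⟩
      · exact ⟨-1, by simp [h]⟩
    choose d hd using hd
    have hs : ∀ u : Fin k → Fin n, ∃ e : ℤˣ, ∀ (S : {S : Finset (Fin n) // S.card = k})
        (π : Perm (Fin k)), u = S.1.orderEmbOfFin S.2 ∘ π → e = Perm.sign π * d S := by
      intro u
      by_cases hu : Function.Injective u
      · obtain ⟨S, π, h⟩ := exists_eq_orderEmbOfFin_comp hu
        refine ⟨Perm.sign π * d S, fun T ρ h' => ?_⟩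
        obtain ⟨rfl, rfl⟩ := orderEmbOfFin_comp_injective (h.symm.trans h')
        rfl
      · refine ⟨1, fun S π h => absurd ?_ hu⟩
        rw [h]
        exact (S.1.orderEmbOfFin S.2).injective.comp π.injective
    choose s hs using hs
    refine ⟨s, ?_, ?_⟩
    · intro u hu π
      obtain ⟨S, ρ, h⟩ := exists_eq_orderEmbOfFin_comp hu
      rw [hs u S ρ h, hs (u ∘ π) S (ρ * π) (by rw [h]; rfl), Perm.sign_mul, ← mul_assoc,
        mul_comm (Perm.sign ρ)]
    · intro u i w hu hw hA
      obtain ⟨S, π, h⟩ := exists_eq_orderEmbOfFin_comp hu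
      obtain ⟨T, ρ, h'⟩ := exists_eq_orderEmbOfFin_comp (injective_update hu i hw)
      rw [hs _ _ _ h, hs _ _ _ h']
      subst h
      have hB := extPow_of_update hdiag h01 hw hA h'
      have := hent S T
      rw [hB, hd, hd] at this
      norm_cast at this
      rcases Int.units_eq_one_or (Perm.sign π) with h1 | h1 <;>
      rcases Int.units_eq_one_or (Perm.sign ρ) with h2 | h2 <;>
      rcases Int.units_eq_one_or (d S) with h3 | h3 <;>
      rcases Int.units_eq_one_or (d T) with h4 | h4 <;>
      simp [h1, h2, h3, h4] at this ⊢
  · rintro ⟨s, hs1, hs2⟩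
    refine ⟨Matrix.diagonal fun S => ((s (S.1.orderEmbOfFin S.2) : ℤ) : ℝ),
      Matrix.isDiag_diagonal _, fun S => ?_, ?_⟩
    · rcases Int.units_eq_one_or (s (S.1.orderEmbOfFin S.2)) with h | h <;> simp [h]
    ext S T
    simp only [Matrix.mul_diagonal, Matrix.diagonal_mul, Matrix.of_apply]
    have hnn : 0 ≤ ((s (S.1.orderEmbOfFin S.2) : ℤ) : ℝ) * extPow A k S T *
        ((s (T.1.orderEmbOfFin T.2) : ℤ) : ℝ) := by
      rw [extPow_apply, Finset.mul_sum, Finset.sum_mul]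
      refine Finset.sum_nonneg fun σ _ => ?_
      by_cases h0 : cartPow A k (S.1.orderEmbOfFin S.2) (T.1.orderEmbOfFin T.2 ∘ σ) = 0
      · simp [h0]
      obtain ⟨i, w, hw, hwu, hA⟩ := exists_update_of_cartPow_ne_zero hdiag h01
        ((T.1.orderEmbOfFin T.2).injective.comp σ.injective) h0
      have h1 := hs1 _ (T.1.orderEmbOfFin T.2).injective σ
      rw [hw, hs2 _ i w (S.1.orderEmbOfFin S.2).injective hwu hA] at h1
      have hpos := cartPow_nonneg h01 (S.1.orderEmbOfFin S.2) (T.1.orderEmbOfFin T.2 ∘ σ)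
      rw [h1]
      rcases Int.units_eq_one_or (s (T.1.orderEmbOfFin T.2)) with h2 | h2 <;>
      rcases Int.units_eq_one_or (Perm.sign σ) with h3 | h3 <;> simpa [h2, h3] using hpos
    rw [← abs_of_nonneg hnn]
    rcases Int.units_eq_one_or (s (T.1.orderEmbOfFin T.2)) with h2 | h2 <;>
    rcases Int.units_eq_one_or (s (S.1.orderEmbOfFin S.2)) with h3 | h3 <;> simp [h2, h3]

end CartPow

section Claw

variable {n : ℕ} {A : Matrix (Fin n) (Fin n) ℝ}

theorem IsOrientation.cons_cons_swap {m : ℕ} {s : (Fin (m + 2) → Fin n) → ℤˣ}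
    (hs : IsOrientation A s) {r : Fin m → Fin n} {x y : Fin n}
    (h : Function.Injective (Fin.cons x (Fin.cons y r : Fin (m + 1) → Fin n) :
      Fin (m + 2) → Fin n)) :
    s (Fin.cons y (Fin.cons x r : Fin (m + 1) → Fin n)) =
      -s (Fin.cons x (Fin.cons y r : Fin (m + 1) → Fin n)) := by
  have h1 := hs.1 _ h (Equiv.swap 0 1)
  rw [Perm.sign_swap (by simp), neg_one_mul] at h1
  rw [← h1]
  congr 1
  ext1 i
  refine Fin.cases ?_ (fun i => Fin.cases ?_ (fun i => ?_) i) i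
  · simp [Fin.cons_one]
  · simp [Fin.cons_one]
  · have : (Equiv.swap (0 : Fin (m + 2)) 1) i.succ.succ = i.succ.succ :=
      Equiv.swap_apply_of_ne_of_ne (Fin.succ_ne_zero _)
        (fun h => Fin.succ_ne_zero i (Fin.succ_injective _ h))
    simp [this]

theorem not_isOrientation_of_claw (hsym : A.IsSymm) (hdiag : ∀ i, A i i = 0) {m : ℕ}
    (hm : m + 4 ≤ n) {s : (Fin (m + 2) → Fin n) → ℤˣ} (hs : IsOrientation A s)
    {c a b d : Fin n} (hca : A c a = 1) (hcb : A c b = 1) (hcd : A c d = 1)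
    (hab : a ≠ b) (had : a ≠ d) (hbd : b ≠ d) : False := by
  have hne : ∀ {x y}, A x y = 1 → x ≠ y := by
    rintro x y h rfl
    rw [hdiag] at h; exact zero_ne_one h
  have hsy : ∀ {x y}, A x y = 1 → A y x = 1 := fun h => (hsym.apply _ _).trans h
  obtain ⟨e⟩ : Nonempty (Fin m ↪ {x // x ∉ ({c, a, b, d} : Finset (Fin n))}) := by
    refine Function.Embedding.nonempty_of_card_le ?_
    have h4 : ({c, a, b, d} : Finset (Fin n)).card ≤ 4 := Finset.card_le_four
    rw [Fintype.card_fin, Fintype.card_subtype_compl, Fintype.card_fin, Fintype.card_coe]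
    omega
  let r : Fin m → Fin n := fun i => e i
  have hr : Function.Injective r := Subtype.val_injective.comp e.injective
  have hrn : ∀ i, r i ≠ c ∧ r i ≠ a ∧ r i ≠ b ∧ r i ≠ d := by
    intro i
    have := (e i).2
    simpa using this
  let u : Fin n → Fin n → Fin (m + 2) → Fin n := fun x y =>
    Fin.cons x (Fin.cons y r : Fin (m + 1) → Fin n)
  have hu : ∀ x y, x ≠ y → (∀ i, r i ≠ x) → (∀ i, r i ≠ y) → Function.Injective (u x y) := by
    intro x y hxy hx hy
    refine Fin.cons_injective_iff.2 ⟨?_, Fin.cons_injective_iff.2 ⟨?_, hr⟩⟩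
    · rintro ⟨i, hi⟩
      refine Fin.cases (fun h => hxy (by simpa using h.symm)) (fun i h => hx i ?_) i hi
      simpa using h
    · rintro ⟨i, hi⟩
      exact hy i hi
  have hmove : ∀ x y z, x ≠ y → z ≠ x → z ≠ y → (∀ i, r i ≠ x) → (∀ i, r i ≠ y) →
      (∀ i, r i ≠ z) → A x z = 1 → s (u z y) = s (u x y) := by
    intro x y z hxy hzx hzy hx hy hz hA
    have := hs.2 (u x y) 0 z (hu x y hxy hx hy) ?_ (by simpa [u] using hA)
    · rwa [Fin.update_cons_zero] at this
    · intro j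
      refine Fin.cases ?_ (fun j => Fin.cases ?_ (fun j => ?_) j) j
      · simpa [u] using hzx.symm
      · simpa [u] using hzy.symm
      · simpa [u] using hz j
  have hswap : ∀ x y, x ≠ y → (∀ i, r i ≠ x) → (∀ i, r i ≠ y) → s (u y x) = -s (u x y) :=
    fun x y hxy hx hy => hs.cons_cons_swap (hu x y hxy hx hy)
  have rc := fun i => (hrn i).1
  have ra := fun i => (hrn i).2.1
  have rb := fun i => (hrn i).2.2.1
  have rd := fun i => (hrn i).2.2.2
  have nca := hne hca
  have ncb := hne hcb
  have ncd := hne hcd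
  have e1 := hmove c a b nca ncb.symm hab.symm rc ra rb hcb
  have e2 := hswap a b hab ra rb
  have e3 := hmove a b c hab nca ncb ra rb rc (hsy hca)
  have e4 := hmove c b d ncb ncd.symm hbd.symm rc rb rd hcd
  have e5 := hswap b d hbd rb rd
  have e6 := hmove b d c hbd ncb ncd rb rd rc (hsy hcb)
  have e7 := hmove c d a ncd nca.symm had rc rd ra hca
  have e8 := hswap a d had ra rd
  have e9 := hmove d a c had.symm ncd nca rd ra rc (hsy hcd)
  rcases Int.units_eq_one_or (s (u c a)) with h | h <;> simp_all

end Claw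

section Structure

variable {n : ℕ} {G : SimpleGraph (Fin n)}

/-- The first `m` values of `f` form a path of `G`. -/
def IsPathSeq (G : SimpleGraph (Fin n)) (m : ℕ) (f : ℕ → Fin n) : Prop :=
  (∀ i j, i < m → j < m → f i = f j → i = j) ∧ ∀ i, i + 1 < m → G.Adj (f i) (f (i + 1))

theorem IsPathSeq.le {m : ℕ} {f : ℕ → Fin n} (hf : IsPathSeq G m f) : m ≤ n := by
  have : Function.Injective (fun i : Fin m => f i) :=
    fun i j h => Fin.ext (hf.1 i j i.2 j.2 h)
  simpa using Fintype.card_le_of_injective _ this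

theorem IsPathSeq.reverse {m : ℕ} {f : ℕ → Fin n} (hf : IsPathSeq G m f) :
    IsPathSeq G m fun i => f (m - 1 - i) := by
  refine ⟨fun i j hi hj h => ?_, fun i hi => ?_⟩
  · have := hf.1 _ _ (by omega) (by omega) h
    omega
  · have := hf.2 (m - 1 - (i + 1)) (by omega)
    rw [show m - 1 - (i + 1) + 1 = m - 1 - i by omega] at this
    exact this.symm

theorem IsPathSeq.exists_eq_of_adj_last {m : ℕ} {f : ℕ → Fin n} (hf : IsPathSeq G m f)
    (hm : 0 < m) (hmax : ∀ f, ¬ IsPathSeq G (m + 1) f) {w : Fin n}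
    (hw : G.Adj (f (m - 1)) w) : ∃ i < m, f i = w := by
  by_contra! hne
  refine hmax (Function.update f m w) ⟨fun i j hi hj h => ?_, fun i hi => ?_⟩
  · by_cases him : i = m <;> by_cases hjm : j = m
    · omega
    · subst him
      rw [Function.update_self, Function.update_of_ne hjm] at h
      exact absurd h.symm (hne j (by omega))
    · subst hjm
      rw [Function.update_self, Function.update_of_ne him] at h
      exact absurd h (hne i (by omega))
    · rw [Function.update_of_ne him, Function.update_of_ne hjm] at h
      exact hf.1 i j (by omega) (by omega) h
  · rw [Function.update_of_ne (by omega)]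
    by_cases him : i + 1 = m
    · subst him; simpa using hw
    · rw [Function.update_of_ne him]; exact hf.2 i (by omega)

/-- A connected graph with maximum degree at most two has a Hamiltonian path, and there are no
edges besides those of the path and possibly one joining its ends. -/
theorem exists_isPathSeq_of_connected (hG : G.Connected)
    (hdeg : ∀ c a b d, G.Adj c a → G.Adj c b → G.Adj c d → a = b ∨ a = d ∨ b = d) :
    ∃ f : ℕ → Fin n, IsPathSeq G n f ∧
      ∀ i j, i < j → j < n → G.Adj (f i) (f j) → i + 1 = j ∨ (i = 0 ∧ j + 1 = n) := by
  classical
  have hn : 0 < n := Fin.pos hG.nonempty.some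
  have h1 : ∃ f, IsPathSeq G 1 f := ⟨fun _ => hG.nonempty.some,
    fun i j hi hj _ => by omega, fun i hi => by omega⟩
  obtain ⟨m, hm1, ⟨f, hf⟩, hmax⟩ : ∃ m, 0 < m ∧ (∃ f, IsPathSeq G m f) ∧
      ∀ f, ¬ IsPathSeq G (m + 1) f := by
    refine ⟨Nat.findGreatest (fun m => ∃ f, IsPathSeq G m f) n,
      Nat.le_findGreatest hn h1, Nat.findGreatest_spec (P := fun m => ∃ f, IsPathSeq G m f) hn h1,
      fun f hf => ?_⟩
    have := Nat.le_findGreatest (P := fun m => ∃ f, IsPathSeq G m f) hf.le ⟨f, hf⟩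
    omega
  have hint : ∀ i w, 0 < i → i + 1 < m → G.Adj (f i) w → w = f (i - 1) ∨ w = f (i + 1) := by
    intro i w hi him hw
    have hp := hf.2 (i - 1) (by omega)
    rw [Nat.sub_add_cancel hi] at hp
    rcases hdeg _ _ _ _ hp.symm (hf.2 i him) hw with h | h | h
    · have := hf.1 _ _ (by omega) (by omega) h
      omega
    · exact Or.inl h.symm
    · exact Or.inr h.symm
  have hclosed : ∀ v w, G.Adj v w → (∃ i < m, f i = v) → ∃ i < m, f i = w := by
    rintro _ w hw ⟨i, hi, rfl⟩
    by_cases hi0 : i = 0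
    · subst hi0
      obtain ⟨j, hj, h⟩ := hf.reverse.exists_eq_of_adj_last hm1 hmax (w := w) (by simpa using hw)
      exact ⟨_, by omega, h⟩
    by_cases him : i + 1 = m
    · subst him
      exact hf.exists_eq_of_adj_last hm1 hmax hw
    rcases hint i w (by omega) (by omega) hw with h | h
    · exact ⟨_, by omega, h.symm⟩
    · exact ⟨_, by omega, h.symm⟩
  have hall : ∀ v, ∃ i < m, f i = v := by
    intro v
    obtain ⟨p⟩ := hG.preconnected (f 0) v
    have : ∀ x y, G.Walk x y → (∃ i < m, f i = x) → ∃ i < m, f i = y := by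
      intro x y p
      induction p with
      | nil => exact id
      | cons h _ ih => exact fun hx => ih (hclosed _ _ h hx)
    exact this _ _ p ⟨0, hm1, rfl⟩
  obtain rfl : m = n := by
    refine le_antisymm hf.le ?_
    have : Function.Surjective (fun i : Fin m => f i) := fun v => by
      obtain ⟨i, hi, h⟩ := hall v
      exact ⟨⟨i, hi⟩, h⟩
    simpa using Fintype.card_le_of_surjective _ this
  refine ⟨f, hf, fun i j hij hj hadj => ?_⟩
  by_cases hjm : j + 1 = m
  · by_cases hi0 : i = 0
    · exact Or.inr ⟨hi0, hjm⟩
    · rcases hint i _ (by omega) (by omega) hadj with h | h <;>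
        have := hf.1 _ _ (by omega) (by omega) h <;> omega
  · rcases hint j _ (by omega) (by omega) hadj.symm with h | h <;>
      have := hf.1 _ _ (by omega) (by omega) h <;> omega

theorem intModEq_cyclic_iff {n : ℕ} (hn : 2 ≤ n) (i j : Fin n) :
    ((i : ℤ) - j ≡ 1 [ZMOD (n : ℤ)] ∨ (i : ℤ) - j ≡ -1 [ZMOD (n : ℤ)]) ↔
      (i : ℕ) + 1 = j ∨ (j : ℕ) + 1 = i ∨ ((i : ℕ) = 0 ∧ (j : ℕ) + 1 = n) ∨
        ((j : ℕ) = 0 ∧ (i : ℕ) + 1 = n) := by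
  have key : ∀ i j : Fin n, (i : ℤ) - j ≡ 1 [ZMOD (n : ℤ)] ↔
      (j : ℕ) + 1 = i ∨ ((i : ℕ) = 0 ∧ (j : ℕ) + 1 = n) := by
    intro i j
    have hi := i.2
    have hj := j.2
    rw [Int.modEq_iff_dvd]
    constructor
    · rintro ⟨c, hc⟩
      have h1 : c < 2 := by
        by_contra! h
        nlinarith
      have h2 : -1 < c := by
        by_contra! h
        nlinarith
      interval_cases c <;> omega
    · rintro (h | ⟨h, h'⟩)
      · exact ⟨0, by omega⟩
      · exact ⟨1, by omega⟩
  have hneg : (i : ℤ) - j ≡ -1 [ZMOD (n : ℤ)] ↔ (j : ℤ) - i ≡ 1 [ZMOD (n : ℤ)] := by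
    rw [← Int.neg_modEq_neg, neg_sub, neg_neg]
  rw [hneg, key, key]
  tauto

end Structure

section Cycle

variable {n k : ℕ} {A : Matrix (Fin n) (Fin n) ℝ}

theorem not_isOrientation_of_cycle_of_even (hn : 0 < n) {q : ℕ → Fin n}
    (hq : ∀ i j, i < n → j < n → q i = q j → i = j)
    (hstep : ∀ i, i + 1 < n → A (q i) (q (i + 1)) = 1 ∧ A (q (i + 1)) (q i) = 1)
    (hlast : A (q (n - 1)) (q 0) = 1) (hk : Even k) (hk0 : 0 < k) (hkn : k < n)
    {s : (Fin k → Fin n) → ℤˣ} (hs : IsOrientation A s) : False := by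
  obtain ⟨m, rfl⟩ : ∃ m, k = m + 1 := ⟨k - 1, by omega⟩
  -- The first `m` entries are `0, …, m` with `a` left out, the last one is `x`.
  let w : ℕ → ℕ → Fin (m + 1) → ℕ := fun a x i =>
    if (i : ℕ) = m then x else if (i : ℕ) < a then i else i + 1
  have hwn : ∀ a x i, x < n → w a x i < n := by
    intro a x i hx
    have := i.2
    simp only [w]
    split_ifs <;> omega
  have hwi : ∀ a x, a ≤ m → x < n → (x = a ∨ m < x) → Function.Injective (q ∘ w a x) := by
    intro a x ha hx hax i j hij
    have := hq _ _ (hwn a x i hx) (hwn a x j hx) hij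
    have hi := i.2
    have hj := j.2
    simp only [w] at this
    ext
    split_ifs at this <;> omega
  have hmove : ∀ a x b y (i : Fin (m + 1)), a ≤ m → x < n → (x = a ∨ m < x) → y < n →
      b ≤ m → (y = b ∨ m < y) →
      (∀ j, j ≠ i → w b y j = w a x j) → w b y i ≠ w a x i →
      A (q (w a x i)) (q (w b y i)) = 1 →
      s (q ∘ w b y) = s (q ∘ w a x) := by
    intro a x b y i ha hx hax hy hb hby hj hi hA
    have hup : q ∘ w b y = Function.update (q ∘ w a x) i (q (w b y i)) := by
      ext1 j
      by_cases hji : j = i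
      · subst hji; simp
      · simp [hji, hj j hji]
    rw [hup]
    refine hs.2 _ i _ (hwi a x ha hx hax) (fun j h => ?_) hA
    have h' := hq _ _ (hwn a x j hx) (hwn b y i hy) h
    by_cases hji : j = i
    · subst hji; exact hi h'.symm
    · rw [← hj j hji] at h'
      exact hji (hwi b y hb hy hby (congrArg q h'))
  have hright : ∀ x, m ≤ x → x < n → s (q ∘ w m x) = s (q ∘ w m m) := by
    intro x hx
    induction x, hx using Nat.le_induction with
    | base => exact fun _ => rfl
    | succ x hx ih =>
      intro hxn
      rw [← ih (by omega)]
      refine hmove m x m (x + 1) (Fin.last m) le_rfl (by omega) (by omega) hxn le_rfl (by omega)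
        (fun j hj => ?_) (by simp [w]) ?_
      · have : (j : ℕ) ≠ m := fun h => hj (Fin.ext h)
        simp [w, this]
      · simpa [w] using (hstep x hxn).1
  have hshift : ∀ a, a ≤ m → s (q ∘ w (m - a) (n - 1)) = s (q ∘ w m (n - 1)) := by
    intro a
    induction a with
    | zero => simp
    | succ a ih =>
      intro ha
      rw [← ih (by omega)]
      obtain ⟨b, hb⟩ : ∃ b, m - a = b + 1 := ⟨m - a - 1, by omega⟩
      rw [show m - (a + 1) = b by omega, hb]
      have hbm : b ≠ m := by omega
      refine hmove (b + 1) (n - 1) b (n - 1) ⟨b, by omega⟩ (by omega) (by omega) (by omega)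
        (by omega) (by omega) (by omega) (fun j hj => ?_) (by simp [w, hbm]) ?_
      · have : (j : ℕ) ≠ b := fun h => hj (Fin.ext h)
        simp only [w]
        split_ifs <;> omega
      · simpa [w, hbm] using (hstep b (by omega)).1
  have hclose : s (q ∘ w 0 0) = s (q ∘ w 0 (n - 1)) := by
    refine hmove 0 (n - 1) 0 0 (Fin.last m) (by omega) (by omega) (by omega) (by omega)
      (by omega) (by omega) (fun j hj => ?_) ?_ ?_
    · have : (j : ℕ) ≠ m := fun h => hj (Fin.ext h)
      simp [w, this]
    · simp [w]; omega
    · simpa [w] using hlast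
  have hrot : q ∘ w 0 0 = (q ∘ w m m) ∘ finRotate (m + 1) := by
    ext1 i
    simp only [Function.comp]
    congr 1
    by_cases hi : i = Fin.last m
    · subst hi
      rw [finRotate_last]
      rcases Nat.eq_zero_or_pos m with h | h
      · subst h; simp [w]
      · simp [w, h, h.ne]
    · have hi' : (i : ℕ) ≠ m := fun h => hi (Fin.ext h)
      have := i.2
      simp only [w, coe_finRotate_of_ne_last hi]
      split_ifs <;> omega
  have h1 := hs.1 _ (hwi m m le_rfl (by omega) (Or.inl rfl)) (finRotate (m + 1))
  rw [← hrot, hclose, sign_finRotate, ← Nat.sub_self m, hshift m le_rfl,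
    hright (n - 1) (by omega) (by omega)] at h1
  have hodd : Odd m := by
    rcases Nat.even_or_odd m with h | h
    · exact absurd hk (by simpa using h.add_one)
    · exact h
  rw [Nat.add_sub_cancel, hodd.neg_one_pow] at h1
  rcases Int.units_eq_one_or (s (q ∘ w m m)) with h | h <;> simp [h] at h1

theorem eq_sort_of_strictMono {f : Fin k → Fin n} {σ : Perm (Fin k)} (h : StrictMono (f ∘ σ)) :
    Tuple.sort f = σ :=
  (Tuple.eq_sort_iff.2 ⟨h.monotone, fun _ _ hij he => absurd he (h hij).ne⟩).symm

theorem strictMono_comp_sort {f : Fin k → Fin n} (hf : Function.Injective f) :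
    StrictMono (f ∘ Tuple.sort f) :=
  (Tuple.monotone_sort f).strictMono_of_injective (hf.comp (Tuple.sort f).injective)

/-- The sign of the permutation sorting the positions (under `g`) of the entries of `u`. -/
def sortSign (g : Perm (Fin n)) (u : Fin k → Fin n) : ℤˣ :=
  Perm.sign (Tuple.sort (g.symm ∘ u))

theorem sortSign_comp_perm (g : Perm (Fin n)) {u : Fin k → Fin n} (hu : Function.Injective u)
    (π : Perm (Fin k)) : sortSign g (u ∘ π) = Perm.sign π * sortSign g u := by
  have : Tuple.sort (g.symm ∘ u ∘ π) = π⁻¹ * Tuple.sort (g.symm ∘ u) := by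
    refine eq_sort_of_strictMono ?_
    convert strictMono_comp_sort (g.symm.injective.comp hu) using 1
    ext1 i
    simp
  rw [sortSign, this, Perm.sign_mul, Perm.sign_inv, sortSign]

theorem sort_update_of_adjacent {p : Fin k → Fin n} (hp : Function.Injective p) {i : Fin k}
    {x : Fin n} (hx : ∀ j, p j ≠ x) (h : (p i : ℕ) + 1 = x ∨ (x : ℕ) + 1 = p i) :
    Tuple.sort (Function.update p i x) = Tuple.sort p := by
  refine eq_sort_of_strictMono fun a b hab => ?_
  have h1 := strictMono_comp_sort hp hab
  simp only [Function.comp, Fin.lt_def] at h1 ⊢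
  have hne : ∀ j, (p j : ℕ) ≠ x := fun j hj => hx j (Fin.ext hj)
  have ha := hne (Tuple.sort p a)
  have hb := hne (Tuple.sort p b)
  have hne2 : Tuple.sort p a ≠ Tuple.sort p b := fun h => hab.ne ((Tuple.sort p).injective h)
  by_cases hai : Tuple.sort p a = i <;> by_cases hbi : Tuple.sort p b = i
  · exact absurd (hai.trans hbi.symm) hne2
  · rw [hai, Function.update_self, Function.update_of_ne hbi]
    rw [hai] at h1
    omega
  · rw [hbi, Function.update_self, Function.update_of_ne hai]
    rw [hbi] at h1
    omega
  · rwa [Function.update_of_ne hai, Function.update_of_ne hbi]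

theorem sign_sort_update_zero {p : Fin k → Fin n} (hp : Function.Injective p) (hk : Odd k)
    {i : Fin k} {x : Fin n} (hpi : (p i : ℕ) + 1 = n) (hx0 : (x : ℕ) = 0) (hx : ∀ j, p j ≠ x) :
    Perm.sign (Tuple.sort (Function.update p i x)) = Perm.sign (Tuple.sort p) := by
  obtain ⟨m, rfl⟩ : ∃ m, k = m + 1 := ⟨k - 1, by have := hk.pos; omega⟩
  set σ := Tuple.sort p with hσ
  have hmono : StrictMono (p ∘ σ) := strictMono_comp_sort hp
  have hlast : σ (Fin.last m) = i := by
    have h1 : p i ≤ p (σ (Fin.last m)) := by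
      have := hmono.monotone (Fin.le_last (σ.symm i))
      simpa using this
    refine hp (le_antisymm ?_ h1)
    rw [Fin.le_def]
    have := (p (σ (Fin.last m))).2
    omega
  have hup : ∀ j : Fin m, Function.update p i x (σ j.castSucc) = p (σ j.castSucc) := by
    intro j
    refine Function.update_of_ne (fun h => ?_) _ _
    exact (Fin.castSucc_lt_last j).ne (σ.injective (h.trans hlast.symm))
  have hrot : ∀ j : Fin m, (finRotate (m + 1))⁻¹ j.succ = j.castSucc := by
    intro j
    rw [Perm.inv_eq_iff_eq, finRotate_apply, Fin.coeSucc_eq_succ]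
  have hsort : Tuple.sort (Function.update p i x) = σ * (finRotate (m + 1))⁻¹ := by
    refine eq_sort_of_strictMono fun a b hab => ?_
    simp only [Function.comp, Perm.mul_apply]
    obtain ⟨b, rfl⟩ : ∃ b', b = Fin.succ b' :=
      Fin.exists_succ_eq.2 (Fin.ne_zero_of_lt hab) |>.imp fun _ h => h.symm
    rw [hrot, hup]
    refine Fin.cases (fun _ => ?_) (fun a hab => ?_) a hab
    · have : (finRotate (m + 1))⁻¹ 0 = Fin.last m := by
        rw [Perm.inv_eq_iff_eq, finRotate_last]
      rw [this, hlast, Function.update_self, Fin.lt_def]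
      have : (p (σ b.castSucc) : ℕ) ≠ x := fun h => hx _ (Fin.ext h)
      omega
    · rw [hrot, hup]
      exact hmono (Fin.castSucc_lt_castSucc_iff.2 (Fin.succ_lt_succ_iff.1 hab))
  rw [hsort, Perm.sign_mul, Perm.sign_inv, sign_finRotate, Nat.add_sub_cancel,
    (by rcases hk with ⟨c, hc⟩; exact ⟨c, by omega⟩ : Even m).neg_one_pow, mul_one]

theorem isOrientation_sortSign (g : Perm (Fin n))
    (h : ∀ i j : Fin n, A (g i) (g j) = 1 → ((i : ℕ) + 1 = j ∨ (j : ℕ) + 1 = i) ∨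
      Odd k ∧ (((i : ℕ) = 0 ∧ (j : ℕ) + 1 = n) ∨ ((j : ℕ) = 0 ∧ (i : ℕ) + 1 = n))) :
    IsOrientation A (sortSign g : (Fin k → Fin n) → ℤˣ) := by
  refine ⟨fun u hu π => sortSign_comp_perm g hu π, fun u i w hu hw hA => ?_⟩
  have hp : Function.Injective (g.symm ∘ u) := g.symm.injective.comp hu
  have hx : ∀ j, (g.symm ∘ u) j ≠ g.symm w := fun j hj => hw j (g.symm.injective hj)
  have hup : g.symm ∘ Function.update u i w = Function.update (g.symm ∘ u) i (g.symm w) :=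
    Function.comp_update _ _ _ _
  rw [sortSign, sortSign, hup]
  rcases h (g.symm (u i)) (g.symm w) (by simpa using hA) with h | ⟨hk, h⟩
  · rw [sort_update_of_adjacent hp hx h]
  · rcases h with ⟨h0, hl⟩ | ⟨h0, hl⟩
    · have := sign_sort_update_zero (injective_update hp i hx) hk (i := i) (x := g.symm (u i))
        (by simpa using hl) h0 ?_
      · rw [← this, Function.update_idem]
        congr 2
        exact Function.update_eq_self i (g.symm ∘ u)
      · intro j
        by_cases hji : j = i
        · subst hji
          rw [Function.update_self]
          exact (hx j).symm
        · rw [Function.update_of_ne hji]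
          exact fun h => hji (hp h)
    · exact sign_sort_update_zero hp hk hl h0 hx

end Cycle

section Hole

variable {m : ℕ} {A : Matrix (Fin (m + 1)) (Fin (m + 1)) ℝ}

theorem exists_perm_comp_succ_eq {u : Fin m → Fin (m + 1)} (hu : Function.Injective u) :
    ∃ τ : Perm (Fin (m + 1)), τ ∘ Fin.succ = u := by
  obtain ⟨h, hh⟩ : ∃ h, h ∉ Set.range u := by
    by_contra! hs
    simpa using Fintype.card_le_of_surjective u hs
  have hinj : Function.Injective (Fin.cons h u : Fin (m + 1) → Fin (m + 1)) :=
    Fin.cons_injective_iff.2 ⟨hh, hu⟩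
  refine ⟨Equiv.ofBijective _ (Finite.injective_iff_bijective.1 hinj), ?_⟩
  ext1 i
  simp

theorem perm_ext_of_comp_succ {τ τ' : Perm (Fin (m + 1))} (h : τ ∘ Fin.succ = τ' ∘ Fin.succ) :
    τ = τ' := by
  have hs : ∀ i : Fin m, τ i.succ = τ' i.succ := fun i => congrFun h i
  have h0 : τ 0 = τ' 0 := by
    obtain ⟨i, hi⟩ := τ.surjective (τ' 0)
    refine Fin.cases (fun h => h) (fun i h => ?_) i hi
    rw [hs] at h
    exact absurd (τ'.injective h) (Fin.succ_ne_zero i)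
  exact Equiv.ext fun i => Fin.cases h0 hs i

theorem mul_decomposeFin_comp_succ (τ : Perm (Fin (m + 1))) (π : Perm (Fin m)) :
    (τ * Perm.decomposeFin.symm (0, π) : Perm (Fin (m + 1))) ∘ Fin.succ = τ ∘ Fin.succ ∘ π := by
  ext1 i
  simp [Perm.decomposeFin_symm_apply_succ]

theorem mul_swap_comp_succ (τ : Perm (Fin (m + 1))) (i : Fin m) :
    (τ * Equiv.swap 0 i.succ : Perm (Fin (m + 1))) ∘ Fin.succ =
      Function.update (τ ∘ Fin.succ) i (τ 0) := by
  ext1 j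
  by_cases hji : j = i
  · subst hji; simp
  · have : Equiv.swap 0 i.succ j.succ = j.succ :=
      Equiv.swap_apply_of_ne_of_ne (Fin.succ_ne_zero _) fun h => hji (Fin.succ_injective _ h)
    simp [this, hji]

/-- With all vertices but one occupied, only the free vertex matters. -/
theorem exists_isOrientation_iff_bipartite (hdiag : ∀ i, A i i = 0) (hsym : A.IsSymm) :
    (∃ s : (Fin m → Fin (m + 1)) → ℤˣ, IsOrientation A s) ↔
      ∃ f : Fin (m + 1) → Bool, ∀ u v, A u v = 1 → f u ≠ f v := by
  constructor
  · rintro ⟨s, hs1, hs2⟩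
    let t : Perm (Fin (m + 1)) → ℤˣ := fun τ => Perm.sign τ * s (τ ∘ Fin.succ)
    have ht : ∀ τ τ', τ 0 = τ' 0 → t τ = t τ' := by
      intro τ τ' h0
      have hfix : (τ⁻¹ * τ') 0 = 0 := by
        rw [Perm.mul_apply, ← h0, Perm.inv_eq_iff_eq]
      obtain ⟨⟨p, π⟩, hp⟩ := Perm.decomposeFin.symm.surjective (τ⁻¹ * τ')
      obtain rfl : p = 0 := by
        rw [← hp, Perm.decomposeFin_symm_apply_zero] at hfix
        exact hfix
      have hτ : τ' = τ * Perm.decomposeFin.symm (0, π) := by rw [hp, mul_inv_cancel_left]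
      simp only [t]
      rw [hτ, mul_decomposeFin_comp_succ, ← Function.comp_assoc,
        hs1 _ (τ.injective.comp (Fin.succ_injective _)), Perm.sign_mul,
        Perm.decomposeFin.symm_sign]
      rcases Int.units_eq_one_or (Perm.sign π) with h | h <;> simp [h]
    refine ⟨fun h => decide (t (Equiv.swap 0 h) = 1), fun u v huv => ?_⟩
    have huv' : u ≠ v := by
      rintro rfl
      rw [hdiag] at huv; exact zero_ne_one huv
    obtain ⟨i, hi⟩ : ∃ i : Fin m, Equiv.swap 0 u i.succ = v := by
      obtain ⟨j, hj⟩ := (Equiv.swap 0 u).surjective v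
      have hj0 : j ≠ 0 := by
        rintro rfl
        exact huv' (by simpa using hj)
      obtain ⟨i, rfl⟩ := Fin.exists_succ_eq.2 hj0
      exact ⟨i, hj⟩
    have h1 : t (Equiv.swap 0 u * Equiv.swap 0 i.succ) = t (Equiv.swap 0 v) :=
      ht _ _ (by simp [hi])
    have h2 : s (Function.update (Equiv.swap 0 u ∘ Fin.succ) i u) =
        s (Equiv.swap 0 u ∘ Fin.succ) := by
      refine hs2 _ i u ((Equiv.injective _).comp (Fin.succ_injective _)) (fun j h => ?_) ?_
      · have : Equiv.swap 0 u j.succ = Equiv.swap 0 u 0 := by rw [Equiv.swap_apply_left]; exact h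
        exact Fin.succ_ne_zero j (Equiv.injective _ this)
      · rw [Function.comp, hi, hsym.apply]; exact huv
    have h3 : t (Equiv.swap 0 u * Equiv.swap 0 i.succ) = -t (Equiv.swap 0 u) := by
      simp only [t]
      rw [mul_swap_comp_succ, Equiv.swap_apply_left, h2, Perm.sign_mul,
        Perm.sign_swap (Fin.succ_ne_zero i).symm]
      simp
    change decide (t (Equiv.swap 0 u) = 1) ≠ decide (t (Equiv.swap 0 v) = 1)
    rw [← h1, h3]
    rcases Int.units_eq_one_or (t (Equiv.swap 0 u)) with h | h <;> simp [h]
  · rintro ⟨f, hf⟩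
    let e : Fin (m + 1) → ℤˣ := fun h => if f h then 1 else -1
    have he : ∀ u v, A u v = 1 → e u = -e v := by
      intro u v h
      have := hf u v h
      simp only [e]
      cases hu : f u <;> cases hv : f v <;> simp_all
    have hs : ∀ u : Fin m → Fin (m + 1), ∃ x : ℤˣ, ∀ τ : Perm (Fin (m + 1)),
        τ ∘ Fin.succ = u → x = Perm.sign τ * e (τ 0) := by
      intro u
      by_cases hu : ∃ τ : Perm (Fin (m + 1)), τ ∘ Fin.succ = u
      · obtain ⟨τ, hτ⟩ := hu
        refine ⟨Perm.sign τ * e (τ 0), fun τ' hτ' => ?_⟩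
        rw [perm_ext_of_comp_succ (hτ.trans hτ'.symm)]
      · exact ⟨1, fun τ hτ => absurd ⟨τ, hτ⟩ hu⟩
    choose s hs using hs
    refine ⟨s, fun u hu π => ?_, fun u i w hu hw hA => ?_⟩
    · obtain ⟨τ, rfl⟩ := exists_perm_comp_succ_eq hu
      rw [hs _ τ rfl, Function.comp_assoc, hs _ _ (mul_decomposeFin_comp_succ τ π), Perm.sign_mul,
        Perm.decomposeFin.symm_sign, Perm.mul_apply, Perm.decomposeFin_symm_apply_zero]
      rw [if_pos rfl, one_mul, ← mul_assoc, mul_comm (Perm.sign π)]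
    · obtain ⟨τ, rfl⟩ := exists_perm_comp_succ_eq hu
      have hw0 : τ 0 = w := by
        obtain ⟨j, hj⟩ := τ.surjective w
        refine Fin.cases (fun h => h) (fun j h => absurd h (hw j)) j hj
      subst hw0
      rw [hs _ τ rfl, hs _ _ (mul_swap_comp_succ τ i), Perm.sign_mul,
        Perm.sign_swap (Fin.succ_ne_zero i).symm, Perm.mul_apply, Equiv.swap_apply_left,
        show e (τ i.succ) = -e (τ 0) from he _ _ hA]
      simp

end Hole

theorem stmt19 {n : ℕ} (hn : 4 ≤ n) (A : Matrix (Fin n) (Fin n) ℝ)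
    (hsym : A.IsSymm) (hdiag : ∀ i, A i i = 0) (h01 : ∀ i j, A i j = 0 ∨ A i j = 1)
    (hconn : (SimpleGraph.fromRel fun u v => A u v = 1).Connected) :
    (∀ k : ℕ, 2 ≤ k → k ≤ n - 2 →
      (IsBalancedMatrix (extPow A k) ↔
        (∃ g : Equiv.Perm (Fin n), ∀ i j : Fin n,
            A (g i) (g j) = 1 ↔ ((i : ℤ) - j = 1 ∨ (j : ℤ) - i = 1)) ∨
        ((∃ g : Equiv.Perm (Fin n), ∀ i j : Fin n,
            A (g i) (g j) = 1 ↔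
              ((i : ℤ) - j ≡ 1 [ZMOD (n : ℤ)] ∨ (i : ℤ) - j ≡ -1 [ZMOD (n : ℤ)])) ∧
          Odd k))) ∧
    (IsBalancedMatrix (extPow A (n - 1)) ↔
      ∃ f : Fin n → Bool, ∀ u v : Fin n, A u v = 1 → f u ≠ f v) := by

  have hne : ∀ {x y}, A x y = 1 → x ≠ y := by
    rintro x y h rfl
    rw [hdiag] at h; exact zero_ne_one h
  have hsy : ∀ {x y}, A x y = 1 → A y x = 1 := fun h => (hsym.apply _ _).trans h
  constructor
  · intro k hk2 hkn
    simp only [intModEq_cyclic_iff (by omega : 2 ≤ n)]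
    rw [isBalancedMatrix_extPow_iff hdiag h01]
    constructor
    · rintro ⟨s, hs⟩
      obtain ⟨m, rfl⟩ : ∃ m, k = m + 2 := ⟨k - 2, by omega⟩
      set G := SimpleGraph.fromRel fun u v => A u v = 1 with hG
      have hadj : ∀ x y, G.Adj x y ↔ A x y = 1 := by
        intro x y
        rw [hG, SimpleGraph.fromRel_adj]
        exact ⟨fun h => h.2.elim id hsy, fun h => ⟨hne h, Or.inl h⟩⟩
      obtain ⟨f, hf, hfadj⟩ := exists_isPathSeq_of_connected hconn (by
        intro c a b d ha hb hd
        rw [hadj] at ha hb hd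
        by_contra! h
        exact not_isOrientation_of_claw hsym hdiag (by omega) hs ha hb hd h.1 h.2.1 h.2.2)
      have hginj : Function.Injective (fun i : Fin n => f i) :=
        fun i j h => Fin.ext (hf.1 i j i.2 j.2 h)
      let g : Perm (Fin n) := Equiv.ofBijective _ (Finite.injective_iff_bijective.1 hginj)
      have hg : ∀ i, g i = f i := fun _ => rfl
      have hstep : ∀ i j : ℕ, j < n → i + 1 = j → A (f i) (f j) = 1 := by
        rintro i _ hj rfl
        exact (hadj _ _).1 (hf.2 i hj)
      have hstep' : ∀ i j : ℕ, i < n → j < n → A (f i) (f j) = 1 →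
          i + 1 = j ∨ j + 1 = i ∨ (i = 0 ∧ j + 1 = n) ∨ (j = 0 ∧ i + 1 = n) := by
        intro i j hi hj hA
        rcases lt_trichotomy i j with h | rfl | h
        · have := hfadj i j h hj ((hadj _ _).2 hA)
          tauto
        · exact absurd rfl (hne hA)
        · have := hfadj j i h hi ((hadj _ _).2 (hsy hA))
          tauto
      by_cases hc : A (f 0) (f (n - 1)) = 1
      · right
        refine ⟨⟨g, fun i j => ?_⟩, ?_⟩
        · rw [hg, hg]
          refine ⟨hstep' i j i.2 j.2, ?_⟩
          rintro (h | h | ⟨h, h'⟩ | ⟨h, h'⟩)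
          · exact hstep _ _ j.2 h
          · exact hsy (hstep _ _ i.2 h)
          · rw [h, show (j : ℕ) = n - 1 by omega]; exact hc
          · rw [h, show (i : ℕ) = n - 1 by omega]; exact hsy hc
        · rw [← Nat.not_even_iff_odd]
          intro hk
          exact not_isOrientation_of_cycle_of_even (by omega) hf.1
            (fun i hi => ⟨hstep _ _ hi rfl, hsy (hstep _ _ hi rfl)⟩) (hsy hc) hk (by omega)
            (by omega) hs
      · left
        refine ⟨g, fun i j => ?_⟩
        rw [hg, hg]
        constructor
        · intro hA
          rcases hstep' i j i.2 j.2 hA with h | h | ⟨h, h'⟩ | ⟨h, h'⟩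
          · omega
          · omega
          · rw [h, show (j : ℕ) = n - 1 by omega] at hA; exact absurd hA hc
          · rw [h, show (i : ℕ) = n - 1 by omega] at hA; exact absurd (hsy hA) hc
        · rintro (h | h)
          · exact hsy (hstep _ _ i.2 (by omega))
          · exact hstep _ _ j.2 (by omega)
    · rintro (⟨g, hg⟩ | ⟨⟨g, hg⟩, hk⟩)
      · refine ⟨sortSign g, isOrientation_sortSign g fun i j hA => Or.inl ?_⟩
        have := (hg i j).1 hA
        omega
      · refine ⟨sortSign g, isOrientation_sortSign g fun i j hA => ?_⟩
        have := (hg i j).1 hA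
        tauto
  · obtain ⟨m, rfl⟩ : ∃ m, n = m + 1 := ⟨n - 1, by omega⟩
    rw [isBalancedMatrix_extPow_iff hdiag h01]
    exact exists_isOrientation_iff_bipartite hdiag hsym
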